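/- There exist constants c > 0 and c₀ > 0 such that for every R > 0 and every ξ ∈ ℝ² with |ξ| ≥ c₀/R, one has φ_{R,π/4}(ξ) ≥ c·R/|ξ|³ (with no restriction on the argument of ξ). -/

import Mathlib

open Real MeasureTheory Set

noncomputable section

/-- Rotation of the plane by angle `ω` about the origin. -/
def rot (ω : ℝ) (p : ℝ × ℝ) : ℝ × ℝ :=
  (p.1 * Real.cos ω - p.2 * Real.sin ω, p.1 * Real.sin ω + p.2 * Real.cos ω)

/-- Indicator function `1_{r,ν}` of the square `[-r,r]²` rotated counterclockwise by
angle `ν` about the origin. -/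
def sqInd (r ν : ℝ) : ℝ × ℝ → ℝ :=
  Set.indicator (rot ν '' (Set.Icc (-r) r ×ˢ Set.Icc (-r) r)) 1

/-- Fourier transform `1̂_{r,ν}(ξ) = ∫_{ℝ²} 1_{r,ν}(x) e^{-2πi x·ξ} dx`. -/
def ftSq (r ν : ℝ) (ξ : ℝ × ℝ) : ℂ :=
  ∫ x : ℝ × ℝ, (sqInd r ν x : ℂ) *
    Complex.exp (-(2 * (π : ℂ) * Complex.I * ((x.1 * ξ.1 + x.2 * ξ.2 : ℝ) : ℂ)))

/-- Euclidean length `|ξ|` of a plane vector. -/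
def nrm (ξ : ℝ × ℝ) : ℝ := Real.sqrt (ξ.1 ^ 2 + ξ.2 ^ 2)

/-- Averaged squared Fourier decay
`φ_{R,θ}(ξ) = (1/(Rθ)) ∫_{R/2}^R ∫_{-θ}^{θ} |1̂_{r,ν}(ξ)|² dν dr`. -/
def phi (R θ : ℝ) (ξ : ℝ × ℝ) : ℝ :=
  (1 / (R * θ)) * ∫ r in (R/2)..R, ∫ ν in (-θ)..θ, ‖ftSq r ν ξ‖ ^ 2

/-- `ξ` has argument `α`, i.e. `ξ = |ξ|(cos α, sin α)`. -/
def hasArg (ξ : ℝ × ℝ) (α : ℝ) : Prop :=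
  ξ = (nrm ξ * Real.cos α, nrm ξ * Real.sin α)

lemma aux_oneD (r y : ℝ) (hr : 0 ≤ r) :
    ∫ x : ℝ, (Set.indicator (Set.Icc (-r) r) (1 : ℝ → ℂ) x) *
      Complex.exp (-(2 * (π : ℂ) * Complex.I * ((x * y : ℝ) : ℂ)))
      = ((2 * r * Real.sinc (2 * π * r * y) : ℝ) : ℂ) := by
  have h1 : ∀ x : ℝ, (Set.indicator (Set.Icc (-r) r) (1 : ℝ → ℂ) x) *
      Complex.exp (-(2 * (π : ℂ) * Complex.I * ((x * y : ℝ) : ℂ))) =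
      Set.indicator (Set.Icc (-r) r) (fun x : ℝ =>
        Complex.exp (((-(2 * π * y) * x : ℝ) : ℂ) * Complex.I)) x := by
    intro x
    by_cases hx : x ∈ Set.Icc (-r) r
    · rw [Set.indicator_of_mem hx, Set.indicator_of_mem hx, Pi.one_apply, one_mul]
      congr 1
      push_cast
      ring
    · rw [Set.indicator_of_notMem hx, Set.indicator_of_notMem hx, zero_mul]
  simp_rw [h1]
  rw [integral_indicator measurableSet_Icc, integral_Icc_eq_integral_Ioc,
    ← intervalIntegral.integral_of_le (by linarith)]
  by_cases hy : y = 0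
  · subst hy
    simp
    ring
  have hc : (-(2 * π * y)) ≠ 0 := by
    have := Real.pi_pos
    simp [hy, this.ne']
  have h2 := intervalIntegral.integral_comp_mul_left (a := -r) (b := r)
    (fun t : ℝ => Complex.exp ((t : ℂ) * Complex.I)) hc
  rw [h2]
  have h3 : -(2 * π * y) * -r = -(-(2 * π * y) * r) := by ring
  rw [h3, integral_exp_mul_I_eq_sinc]
  have h4 : -(2 * π * y) * r = -(2 * π * r * y) := by ring
  rw [h4, Real.sinc_neg, Complex.real_smul]
  have hπ : (π : ℂ) ≠ 0 := by exact_mod_cast Real.pi_pos.ne'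
  have hy' : (y : ℂ) ≠ 0 := by exact_mod_cast hy
  push_cast
  field_simp

/-- The rotation as a linear map. -/
def rotLin (ν : ℝ) : ℝ × ℝ →ₗ[ℝ] ℝ × ℝ :=
  Matrix.toLin (Module.Basis.finTwoProd ℝ) (Module.Basis.finTwoProd ℝ)
    !![Real.cos ν, -Real.sin ν; Real.sin ν, Real.cos ν]

lemma rotLin_eq (ν : ℝ) : (rotLin ν : ℝ × ℝ → ℝ × ℝ) = rot ν := by
  funext p
  rw [rotLin, Matrix.toLin_finTwoProd_apply, rot]
  ext <;> simp <;> ring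

lemma rotLin_det (ν : ℝ) : LinearMap.det (rotLin ν) = 1 := by
  rw [rotLin, LinearMap.det_toLin, Matrix.det_fin_two_of]
  nlinarith [Real.sin_sq_add_cos_sq ν]

lemma rot_continuous (ν : ℝ) : Continuous (rot ν) := by
  unfold rot
  fun_prop

lemma rot_mp (ν : ℝ) : MeasurePreserving (rot ν) (volume : Measure (ℝ × ℝ)) volume := by
  refine ⟨(rot_continuous ν).measurable, ?_⟩
  rw [← rotLin_eq, Measure.map_linearMap_addHaar_eq_smul_addHaar]
  · simp [rotLin_det]
  · simp [rotLin_det]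

lemma rot_rot (ν : ℝ) (p : ℝ × ℝ) : rot (-ν) (rot ν p) = p := by
  have := Real.sin_sq_add_cos_sq ν
  unfold rot
  ext
  · simp only [Real.cos_neg, Real.sin_neg]
    linear_combination p.1 * this
  · simp only [Real.cos_neg, Real.sin_neg]
    linear_combination p.2 * this

lemma rot_inj (ν : ℝ) : Function.Injective (rot ν) :=
  Function.LeftInverse.injective (rot_rot ν)

lemma ftSq_eq (r ν : ℝ) (ξ : ℝ × ℝ) (hr : 0 ≤ r) :
    ftSq r ν ξ = (((2 * r * Real.sinc (2 * π * r * (rot (-ν) ξ).1)) *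
      (2 * r * Real.sinc (2 * π * r * (rot (-ν) ξ).2)) : ℝ) : ℂ) := by
  have hemb : MeasurableEmbedding (rot ν) :=
    (rot_continuous ν).measurableEmbedding (rot_inj ν)
  unfold ftSq
  rw [← (rot_mp ν).integral_comp hemb]
  rw [Complex.ofReal_mul, ← aux_oneD r _ hr, ← aux_oneD r _ hr, ← integral_prod_mul]
  refine integral_congr_ae (Filter.Eventually.of_forall fun p => ?_)
  have h1 : (sqInd r ν (rot ν p) : ℂ) = Set.indicator (Set.Icc (-r) r) (1 : ℝ → ℂ) p.1 *
      Set.indicator (Set.Icc (-r) r) (1 : ℝ → ℂ) p.2 := by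
    unfold sqInd
    have hm : rot ν p ∈ rot ν '' (Set.Icc (-r) r ×ˢ Set.Icc (-r) r) ↔
        p.1 ∈ Set.Icc (-r) r ∧ p.2 ∈ Set.Icc (-r) r := by
      rw [(rot_inj ν).mem_set_image, Set.mem_prod]
    classical
    simp only [Set.indicator_apply, hm, Pi.one_apply]
    by_cases h1 : p.1 ∈ Set.Icc (-r) r <;> by_cases h2 : p.2 ∈ Set.Icc (-r) r <;>
      simp only [h1, h2] <;> simp
  simp only [h1]
  rw [mul_mul_mul_comm, ← Complex.exp_add]
  congr 2
  simp only [rot, Real.cos_neg, Real.sin_neg]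
  push_cast
  ring

/-- Real form of the squared transform. -/
def gSq (ξ : ℝ × ℝ) (r ν : ℝ) : ℝ :=
  ((2 * r * Real.sinc (2 * π * r * (rot (-ν) ξ).1)) *
      (2 * r * Real.sinc (2 * π * r * (rot (-ν) ξ).2))) ^ 2

lemma gSq_cont (ξ : ℝ × ℝ) : Continuous (Function.uncurry (gSq ξ)) := by
  have := Real.continuous_sinc
  simp only [Function.uncurry_def, gSq, rot]
  fun_prop

lemma gSq_periodic (ξ : ℝ × ℝ) (r : ℝ) : Function.Periodic (gSq ξ r) (π / 2) := by
  intro ν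
  have h1 : (rot (-(ν + π / 2)) ξ).1 = (rot (-ν) ξ).2 := by
    simp only [rot, Real.cos_neg, Real.sin_neg, Real.cos_add_pi_div_two, Real.sin_add_pi_div_two]
    ring
  have h2 : (rot (-(ν + π / 2)) ξ).2 = -(rot (-ν) ξ).1 := by
    simp only [rot, Real.cos_neg, Real.sin_neg, Real.cos_add_pi_div_two, Real.sin_add_pi_div_two]
    ring
  unfold gSq
  rw [h1, h2, mul_neg, Real.sinc_neg, mul_comm]

lemma half_le_sinc {x : ℝ} (h0 : 0 ≤ x) (h1 : x ≤ 1) : 1 / 2 ≤ Real.sinc x := by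
  rcases h0.eq_or_lt with rfl | h
  · simp; norm_num
  · rw [Real.sinc_of_ne_zero h.ne', le_div_iff₀ h]
    nlinarith [Real.sin_gt_sub_cube h, mul_pos h h]

lemma exists_arg (ξ : ℝ × ℝ) : ∃ α : ℝ, ξ.1 = nrm ξ * Real.cos α ∧ ξ.2 = nrm ξ * Real.sin α := by
  refine ⟨Complex.arg ⟨ξ.1, ξ.2⟩, ?_, ?_⟩
  · have := Complex.norm_mul_cos_arg ⟨ξ.1, ξ.2⟩
    rw [Complex.norm_eq_sqrt_sq_add_sq] at this
    exact this.symm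
  · have := Complex.norm_mul_sin_arg ⟨ξ.1, ξ.2⟩
    rw [Complex.norm_eq_sqrt_sq_add_sq] at this
    exact this.symm

lemma gSq_shift (ξ : ℝ × ℝ) (α r s : ℝ) (h1 : ξ.1 = nrm ξ * Real.cos α)
    (h2 : ξ.2 = nrm ξ * Real.sin α) :
    gSq ξ r (s + α) = ((2 * r * Real.sinc (2 * π * r * (nrm ξ * Real.cos s))) *
      (2 * r * Real.sinc (2 * π * r * (nrm ξ * Real.sin s)))) ^ 2 := by
  have e1 : (rot (-(s + α)) ξ).1 = nrm ξ * Real.cos s := by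
    simp only [rot, Real.cos_neg, Real.sin_neg, Real.cos_add, Real.sin_add]
    rw [h1, h2]
    linear_combination (nrm ξ * Real.cos s) * Real.sin_sq_add_cos_sq α
  have e2 : (rot (-(s + α)) ξ).2 = -(nrm ξ * Real.sin s) := by
    simp only [rot, Real.cos_neg, Real.sin_neg, Real.cos_add, Real.sin_add]
    rw [h1, h2]
    linear_combination (-nrm ξ * Real.sin s) * Real.sin_sq_add_cos_sq α
  unfold gSq
  rw [e1, e2, mul_neg, Real.sinc_neg]

lemma pointwise_bound (R ρ r s : ℝ) (hR : 0 < R) (hρ : 1 ≤ R * ρ) (hρ0 : 0 < ρ)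
    (hr1 : R / 2 ≤ r) (hr2 : r ≤ R) (hs0 : 0 ≤ s) (hs1 : s ≤ 1 / (8 * (R * ρ))) :
    R ^ 2 / (4 * π ^ 2 * ρ ^ 2) * (Real.sin (2 * π * ρ * r) ^ 2 / 2 - 1 / 256) ≤
    ((2 * r * Real.sinc (2 * π * r * (ρ * Real.cos s))) *
      (2 * r * Real.sinc (2 * π * r * (ρ * Real.sin s)))) ^ 2 := by
  have hπ := Real.pi_pos
  have hπ4 := Real.pi_lt_four
  have hr : 0 < r := by linarith
  have hs8 : R * ρ * s ≤ 1 / 8 := by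
    rw [le_div_iff₀ (by positivity)] at hs1
    linarith
  have hs18 : s ≤ 1 / 8 := by nlinarith
  have hsin0 : 0 ≤ Real.sin s := Real.sin_nonneg_of_nonneg_of_le_pi hs0 (by linarith [Real.pi_gt_three])
  have hsin1 : Real.sin s ≤ s := Real.sin_le hs0
  have hcos1 := Real.one_sub_sq_div_two_le_cos (x := s)
  have hcosle := Real.cos_le_one s
  have hcos0 : 0 < Real.cos s := by nlinarith
  have hrs : r * ρ * s ≤ 1 / 8 := by
    have : r * ρ * s ≤ R * ρ * s := by gcongr
    linarith
  -- second factor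
  have hB : r ≤ 2 * r * Real.sinc (2 * π * r * (ρ * Real.sin s)) := by
    have hx : 2 * π * r * (ρ * Real.sin s) ≤ 1 := by
      have h1 : 2 * π * r * (ρ * Real.sin s) ≤ 2 * π * r * (ρ * s) := by gcongr
      have h2 : 2 * π * r * (ρ * s) = 2 * π * (r * ρ * s) := by ring
      have h3 : 2 * π * (r * ρ * s) ≤ 2 * π * (1 / 8) := by gcongr
      linarith
    have := half_le_sinc (by positivity) hx
    nlinarith
  -- first factor
  have hA : 2 * r * Real.sinc (2 * π * r * (ρ * Real.cos s)) =
      Real.sin (2 * π * r * (ρ * Real.cos s)) / (π * ρ * Real.cos s) := by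
    rw [Real.sinc_of_ne_zero (by positivity)]
    field_simp
  have hA2 : Real.sin (2 * π * r * (ρ * Real.cos s)) ^ 2 / (π ^ 2 * ρ ^ 2) ≤
      (2 * r * Real.sinc (2 * π * r * (ρ * Real.cos s))) ^ 2 := by
    rw [hA, div_pow]
    apply div_le_div_of_nonneg_left (by positivity) (by positivity)
    have : Real.cos s ^ 2 ≤ 1 := by nlinarith
    calc (π * ρ * Real.cos s) ^ 2 = π ^ 2 * ρ ^ 2 * Real.cos s ^ 2 := by ring
      _ ≤ π ^ 2 * ρ ^ 2 * 1 := by gcongr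
      _ = _ := by ring
  have hdiff : |Real.sin (2 * π * ρ * r) - Real.sin (2 * π * r * (ρ * Real.cos s))| ≤ 1 / 16 := by
    refine (Real.abs_sin_sub_sin_le _ _).trans ?_
    have e : 2 * π * ρ * r - 2 * π * r * (ρ * Real.cos s) =
        2 * π * (r * ρ) * (1 - Real.cos s) := by ring
    rw [e, abs_of_nonneg (mul_nonneg (by positivity) (by linarith))]
    calc 2 * π * (r * ρ) * (1 - Real.cos s) ≤ 2 * π * (r * ρ) * (s ^ 2 / 2) := by
          gcongr; linarith
      _ = π * (r * ρ * s) * s := by ring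
      _ ≤ 4 * (1 / 8) * (1 / 8) := by gcongr
      _ = 1 / 16 := by norm_num
  have hsq : Real.sin (2 * π * ρ * r) ^ 2 / 2 - 1 / 256 ≤
      Real.sin (2 * π * r * (ρ * Real.cos s)) ^ 2 := by
    have := sq_le_sq' (abs_le.mp hdiff).1 (abs_le.mp hdiff).2
    nlinarith [sq_nonneg (Real.sin (2 * π * ρ * r) - 2 * Real.sin (2 * π * r * (ρ * Real.cos s)))]
  calc R ^ 2 / (4 * π ^ 2 * ρ ^ 2) * (Real.sin (2 * π * ρ * r) ^ 2 / 2 - 1 / 256)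
      ≤ R ^ 2 / (4 * π ^ 2 * ρ ^ 2) * Real.sin (2 * π * r * (ρ * Real.cos s)) ^ 2 := by gcongr
    _ = Real.sin (2 * π * r * (ρ * Real.cos s)) ^ 2 / (π ^ 2 * ρ ^ 2) * (R / 2) ^ 2 := by
        field_simp; ring
    _ ≤ (2 * r * Real.sinc (2 * π * r * (ρ * Real.cos s))) ^ 2 *
        (2 * r * Real.sinc (2 * π * r * (ρ * Real.sin s))) ^ 2 := by
        gcongr
        linarith
    _ = _ := by ring

lemma inner_bound (R r : ℝ) (ξ : ℝ × ℝ) (hR : 0 < R) (hρ : 1 ≤ R * nrm ξ) (hρ0 : 0 < nrm ξ)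
    (hr1 : R / 2 ≤ r) (hr2 : r ≤ R) :
    1 / (8 * (R * nrm ξ)) * (R ^ 2 / (4 * π ^ 2 * nrm ξ ^ 2) *
      (Real.sin (2 * π * nrm ξ * r) ^ 2 / 2 - 1 / 256)) ≤
      ∫ ν in (-(π / 4))..(π / 4), gSq ξ r ν := by
  obtain ⟨α, h1, h2⟩ := exists_arg ξ
  have hc : Continuous (gSq ξ r) := (gSq_cont ξ).comp (Continuous.prodMk_right r)
  have e1 : ∫ ν in (-(π / 4))..(π / 4), gSq ξ r ν = ∫ s in (0:ℝ)..(π / 2), gSq ξ r (s + α) := by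
    have := (gSq_periodic ξ r).intervalIntegral_add_eq (-(π / 4)) α
    rw [show -(π / 4) + π / 2 = π / 4 by ring] at this
    rw [this, intervalIntegral.integral_comp_add_right (fun x => gSq ξ r x)]
    congr 1 <;> ring
  have hδ : 1 / (8 * (R * nrm ξ)) ≤ π / 2 := by
    rw [div_le_iff₀ (by positivity)]
    nlinarith [Real.pi_gt_three]
  have hδ0 : 0 ≤ 1 / (8 * (R * nrm ξ)) := by positivity
  have hc' : Continuous fun s => gSq ξ r (s + α) := hc.comp (by fun_prop)
  rw [e1]
  calc _ = ∫ s in (0:ℝ)..(1 / (8 * (R * nrm ξ))), (R ^ 2 / (4 * π ^ 2 * nrm ξ ^ 2) *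
      (Real.sin (2 * π * nrm ξ * r) ^ 2 / 2 - 1 / 256)) := by
        rw [intervalIntegral.integral_const, sub_zero, smul_eq_mul]
    _ ≤ ∫ s in (0:ℝ)..(1 / (8 * (R * nrm ξ))), gSq ξ r (s + α) := by
        apply intervalIntegral.integral_mono_on hδ0
        · exact intervalIntegrable_const
        · exact hc'.intervalIntegrable _ _
        · intro s hs
          rw [gSq_shift ξ α r s h1 h2]
          exact pointwise_bound R (nrm ξ) r s hR hρ hρ0 hr1 hr2 hs.1 hs.2
    _ ≤ _ := by
        apply intervalIntegral.integral_mono_interval le_rfl hδ0 hδ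
        · exact Filter.Eventually.of_forall fun s => sq_nonneg _
        · exact hc'.intervalIntegrable _ _

lemma sin_int_bound (R ρ : ℝ) (hR : 0 < R) (hρ : 1 ≤ R * ρ) (hρ0 : 0 < ρ) :
    R / 8 ≤ ∫ r in (R / 2)..R, Real.sin (2 * π * ρ * r) ^ 2 := by
  have hπ := Real.pi_gt_three
  have hk : 2 * π * ρ ≠ 0 := by positivity
  rw [intervalIntegral.integral_comp_mul_left (fun x => Real.sin x ^ 2) hk, integral_sin_sq,
    smul_eq_mul, inv_mul_eq_div, le_div_iff₀ (by positivity)]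
  have key : ∀ x : ℝ, |Real.sin x * Real.cos x| ≤ 1 / 2 := by
    intro x
    rw [abs_le]
    constructor <;> nlinarith [Real.sin_sq_add_cos_sq x, sq_nonneg (Real.sin x - Real.cos x),
      sq_nonneg (Real.sin x + Real.cos x)]
  have k1 := (abs_le.mp (key (2 * π * ρ * (R / 2)))).1
  have k2 := (abs_le.mp (key (2 * π * ρ * R))).2
  have : 3 ≤ π * (R * ρ) := by nlinarith
  nlinarith

/-- **All rotations (`θ = π/4`).** There are constants `c, c₀ > 0` such that for every
`R > 0` and every `ξ ∈ ℝ²` with `|ξ| ≥ c₀/R`, one has `φ_{R,π/4}(ξ) ≥ c R/|ξ|³`,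
with no restriction on the argument of `ξ`. -/
theorem phi_lower_bound_all_rotations :
    ∃ c > (0:ℝ), ∃ c₀ > (0:ℝ), ∀ R : ℝ, 0 < R →
      ∀ ξ : ℝ × ℝ, c₀ / R ≤ nrm ξ →
        c * R / nrm ξ ^ 3 ≤ phi R (π/4) ξ := by
  refine ⟨1 / (256 * π ^ 3), by positivity, 1, one_pos, ?_⟩
  intro R hR ξ hξ
  have hπ := Real.pi_pos
  have hρ0 : 0 < nrm ξ := lt_of_lt_of_le (by positivity) hξ
  have hρ : 1 ≤ R * nrm ξ := by
    rw [div_le_iff₀ hR] at hξ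
    linarith
  have hphi : phi R (π / 4) ξ = (1 / (R * (π / 4))) *
      ∫ r in (R / 2)..R, ∫ ν in (-(π / 4))..(π / 4), gSq ξ r ν := by
    unfold phi
    congr 1
    apply intervalIntegral.integral_congr
    intro r hr
    rw [Set.uIcc_of_le (by linarith)] at hr
    apply intervalIntegral.integral_congr
    intro ν _
    simp only
    rw [ftSq_eq r ν ξ (by linarith [hr.1]), Complex.norm_real, Real.norm_eq_abs, sq_abs, gSq]
  have hcont : Continuous fun r => ∫ ν in (-(π / 4))..(π / 4), gSq ξ r ν :=
    intervalIntegral.continuous_parametric_intervalIntegral_of_continuous' (gSq_cont ξ) _ _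
  have hmain : 1 / (8 * (R * nrm ξ)) * (R ^ 2 / (4 * π ^ 2 * nrm ξ ^ 2) * (R / 32)) ≤
      ∫ r in (R / 2)..R, ∫ ν in (-(π / 4))..(π / 4), gSq ξ r ν := by
    have hsc : Continuous fun r : ℝ => Real.sin (2 * π * nrm ξ * r) ^ 2 / 2 := by fun_prop
    have hmono := intervalIntegral.integral_mono_on (a := R / 2) (b := R) (μ := volume)
      (f := fun r => 1 / (8 * (R * nrm ξ)) * (R ^ 2 / (4 * π ^ 2 * nrm ξ ^ 2) *
        (Real.sin (2 * π * nrm ξ * r) ^ 2 / 2 - 1 / 256)))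
      (g := fun r => ∫ ν in (-(π / 4))..(π / 4), gSq ξ r ν) (by linarith)
      (Continuous.intervalIntegrable (by fun_prop) _ _) (hcont.intervalIntegrable _ _)
      (fun r hr => inner_bound R r ξ hR hρ hρ0 hr.1 hr.2)
    refine le_trans ?_ hmono
    rw [intervalIntegral.integral_const_mul, intervalIntegral.integral_const_mul,
      intervalIntegral.integral_sub (hsc.intervalIntegrable _ _) intervalIntegrable_const,
      intervalIntegral.integral_div, intervalIntegral.integral_const, smul_eq_mul]
    have := sin_int_bound R (nrm ξ) hR hρ hρ0
    gcongr
    linarith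
  rw [hphi]
  calc 1 / (256 * π ^ 3) * R / nrm ξ ^ 3 = (1 / (R * (π / 4))) *
      (1 / (8 * (R * nrm ξ)) * (R ^ 2 / (4 * π ^ 2 * nrm ξ ^ 2) * (R / 32))) := by
        field_simp
        norm_num
    _ ≤ _ := by gcongr
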